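/- arXiv:2106.05476 — 4 statements merged into one kernel-verified Lean document; each statement's English description precedes it below -/
import Mathlib

section
/- For every integer L ≥ 0, the matrix S − S_L has nonnegative entries and, for every row index i, Σ_{j} (S − S_L)(i, j) ≤ ∏_{k=0}^{L} (1 − α_k); consequently ||S − S_L||_∞ ≤ ∏_{k=0}^{L} (1 − α_k). -/
/-- The supervised PPR proximity matrix
`S = α_0·I + Σ_{l=1}^{∞} α_l · (∏_{k=0}^{l-1} (1 − α_k)) · P^l`, defined entrywise. -/
noncomputable def supPPR (n : ℕ) (P : Matrix (Fin n) (Fin n) ℝ) (α : ℕ → ℝ) :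
    Matrix (Fin n) (Fin n) ℝ :=
  Matrix.of fun i j =>
    α 0 * (if i = j then 1 else 0) +
      ∑' l : ℕ, α (l + 1) * (∏ k ∈ Finset.range (l + 1), (1 - α k)) * (P ^ (l + 1)) i j

/-- The L-hop truncation
`S_L = α_0·I + Σ_{l=1}^{L} α_l · (∏_{k=0}^{l-1} (1 − α_k)) · P^l`. -/
noncomputable def supPPRTrunc (n : ℕ) (P : Matrix (Fin n) (Fin n) ℝ) (α : ℕ → ℝ)
    (L : ℕ) : Matrix (Fin n) (Fin n) ℝ :=
  Matrix.of fun i j =>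
    α 0 * (if i = j then 1 else 0) +
      ∑ l ∈ Finset.range L,
        α (l + 1) * (∏ k ∈ Finset.range (l + 1), (1 - α k)) * (P ^ (l + 1)) i j

/-- The infinity-norm of a matrix: the maximum over rows of the sum of absolute values
of the entries in that row. -/
noncomputable def infNorm {n : ℕ} (M : Matrix (Fin n) (Fin n) ℝ) : ℝ :=
  ⨆ i, ∑ j, |M i j|

/-- For every integer L ≥ 0, the matrix `S − S_L` has nonnegative entries
and, for every row index `i`, `Σ_j (S − S_L)(i, j) ≤ ∏_{k=0}^{L} (1 − α_k)`;
consequently `‖S − S_L‖_∞ ≤ ∏_{k=0}^{L} (1 − α_k)`. -/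
theorem stmt_4 (n : ℕ) (hn : 0 < n) (P : Matrix (Fin n) (Fin n) ℝ)
    (hP_nonneg : ∀ i j, 0 ≤ P i j) (hP_row : ∀ i, ∑ j, P i j = 1)
    (α : ℕ → ℝ) (αmin : ℝ) (hαmin_pos : 0 < αmin) (hαmin_le : αmin ≤ 1)
    (hα : ∀ k : ℕ, αmin ≤ α k ∧ α k ≤ 1) (L : ℕ) :
    (∀ i j, 0 ≤ (supPPR n P α - supPPRTrunc n P α L) i j) ∧
    (∀ i, ∑ j, (supPPR n P α - supPPRTrunc n P α L) i j ≤
        ∏ k ∈ Finset.range (L + 1), (1 - α k)) ∧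
    infNorm (supPPR n P α - supPPRTrunc n P α L) ≤
      ∏ k ∈ Finset.range (L + 1), (1 - α k) := by
  have hPow : ∀ m : ℕ, (∀ i j, 0 ≤ (P ^ m) i j) ∧ (∀ i, ∑ j, (P ^ m) i j = 1) := by
    intro m
    induction m with
    | zero =>
      refine ⟨fun i j => ?_, fun i => ?_⟩
      · rw [pow_zero, Matrix.one_apply]
        split_ifs <;> norm_num
      · simp [Matrix.one_apply]
    | succ m ih =>
      refine ⟨fun i j => ?_, fun i => ?_⟩
      · rw [pow_succ, Matrix.mul_apply]
        exact Finset.sum_nonneg fun k _ => mul_nonneg (ih.1 i k) (hP_nonneg k j)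
      · simp only [pow_succ, Matrix.mul_apply]
        rw [Finset.sum_comm]
        simp only [← Finset.mul_sum, hP_row, mul_one]
        exact ih.2 i
  have hc : ∀ m : ℕ, 0 ≤ ∏ k ∈ Finset.range m, (1 - α k) := fun m =>
    Finset.prod_nonneg fun k _ => by linarith [(hα k).2]
  have hα0 : ∀ k, 0 ≤ α k := fun k => by linarith [(hα k).1]
  have hw : ∀ l : ℕ, 0 ≤ α (l + 1) * (∏ k ∈ Finset.range (l + 1), (1 - α k)) := fun l =>
    mul_nonneg (hα0 _) (hc _)
  have hpart : ∀ M N : ℕ, ∑ l ∈ Finset.range N,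
      α (l + M + 1) * (∏ k ∈ Finset.range (l + M + 1), (1 - α k)) =
      (∏ k ∈ Finset.range (M + 1), (1 - α k)) -
        ∏ k ∈ Finset.range (N + M + 1), (1 - α k) := by
    intro M N
    induction N with
    | zero => simp
    | succ N ih =>
      rw [Finset.sum_range_succ, ih, show N + 1 + M + 1 = (N + M + 1) + 1 by ring,
        Finset.prod_range_succ _ (N + M + 1)]
      ring
  have hf0 : ∀ i j, ∀ l : ℕ, 0 ≤ α (l + 1) * (∏ k ∈ Finset.range (l + 1), (1 - α k)) *
      (P ^ (l + 1)) i j := fun i j l => mul_nonneg (hw l) ((hPow _).1 i j)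
  have hle1 : ∀ m i j, (P ^ m) i j ≤ 1 := fun m i j => by
    rw [← (hPow m).2 i]
    exact Finset.single_le_sum (f := fun j => (P ^ m) i j) (fun k _ => (hPow m).1 i k)
      (Finset.mem_univ j)
  have hsw : Summable fun l : ℕ => α (l + 1) * (∏ k ∈ Finset.range (l + 1), (1 - α k)) := by
    refine summable_of_sum_range_le (c := ∏ k ∈ Finset.range (0 + 1), (1 - α k)) hw ?_
    intro N
    have h := hpart 0 N
    simp only [Nat.add_zero] at h
    rw [h]
    linarith [hc (N + 1)]
  have hs : ∀ i j, Summable fun l : ℕ =>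
      α (l + 1) * (∏ k ∈ Finset.range (l + 1), (1 - α k)) * (P ^ (l + 1)) i j := fun i j =>
    Summable.of_nonneg_of_le (hf0 i j)
      (fun l => mul_le_of_le_one_right (hw l) (hle1 _ i j)) hsw
  have hD : ∀ i j, (supPPR n P α - supPPRTrunc n P α L) i j = ∑' l : ℕ,
      α (l + L + 1) * (∏ k ∈ Finset.range (l + L + 1), (1 - α k)) *
        (P ^ (l + L + 1)) i j := by
    intro i j
    have h := (hs i j).sum_add_tsum_nat_add L
    simp only [supPPR, supPPRTrunc, Matrix.sub_apply, Matrix.of_apply]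
    rw [← h]
    ring
  have h1 : ∀ i j, 0 ≤ (supPPR n P α - supPPRTrunc n P α L) i j := fun i j => by
    rw [hD]
    exact tsum_nonneg fun l => hf0 i j (l + L)
  have h2 : ∀ i, ∑ j, (supPPR n P α - supPPRTrunc n P α L) i j ≤
        ∏ k ∈ Finset.range (L + 1), (1 - α k) := by
    intro i
    simp only [hD]
    rw [← Summable.tsum_finsetSum
      (fun j _ => (summable_nat_add_iff L).2 (hs i j))]
    simp only [← Finset.mul_sum, (hPow _).2, mul_one]
    refine Real.tsum_le_of_sum_range_le (fun l => hw (l + L)) fun N => ?_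
    rw [hpart]
    linarith [hc (N + L + 1)]
  refine ⟨h1, h2, ?_⟩
  haveI : Nonempty (Fin n) := ⟨⟨0, hn⟩⟩
  refine ciSup_le fun i => ?_
  simp only [abs_of_nonneg (h1 _ _)]
  exact h2 i
end

section
/- (Theorem 1) For every integer L ≥ 0, ||S_L − S||_∞ ≤ (∏_{k=0}^{L} (1 − α_k)) · ||S||_∞. -/
theorem aux_prod_nonneg (α : ℕ → ℝ) (h : ∀ k, α k ≤ 1) (m : ℕ) :
    0 ≤ ∏ k ∈ Finset.range m, (1 - α k) :=
  Finset.prod_nonneg fun k _ => by linarith [h k]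

theorem aux_hasSum (α : ℕ → ℝ) (a : ℝ) (ha : 0 < a) (ha1 : a ≤ 1)
    (hα : ∀ k : ℕ, a ≤ α k ∧ α k ≤ 1) (m : ℕ) :
    HasSum (fun l => α (l + m) * ∏ k ∈ Finset.range (l + m), (1 - α k))
      (∏ k ∈ Finset.range m, (1 - α k)) := by
  have hnn := aux_prod_nonneg α (fun k => (hα k).2)
  rw [hasSum_iff_tendsto_nat_of_nonneg
    (fun l => mul_nonneg (by linarith [(hα (l + m)).1]) (hnn _))]
  have hs : ∀ N, ∑ l ∈ Finset.range N, α (l + m) * ∏ k ∈ Finset.range (l + m), (1 - α k)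
      = (∏ k ∈ Finset.range m, (1 - α k)) - ∏ k ∈ Finset.range (N + m), (1 - α k) := by
    intro N
    induction N with
    | zero => simp
    | succ N ih =>
      rw [Finset.sum_range_succ, ih, show N + 1 + m = (N + m) + 1 by ring,
        Finset.prod_range_succ]
      ring
  have hle : ∀ N, ∏ k ∈ Finset.range N, (1 - α k) ≤ (1 - a) ^ N := by
    intro N
    calc _ ≤ ∏ k ∈ Finset.range N, (1 - a) :=
          Finset.prod_le_prod (fun k _ => by linarith [(hα k).2])
            (fun k _ => by linarith [(hα k).1])
      _ = _ := by simp
  have h0 : Filter.Tendsto (fun N => ∏ k ∈ Finset.range N, (1 - α k)) Filter.atTop (nhds 0) :=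
    squeeze_zero hnn hle
      (tendsto_pow_atTop_nhds_zero_of_lt_one (by linarith) (by linarith))
  have h1 := (Filter.tendsto_add_atTop_iff_nat m).2 h0
  simp only [hs]
  simpa using h1.const_sub (∏ k ∈ Finset.range m, (1 - α k))

theorem aux_pow (n : ℕ) (P : Matrix (Fin n) (Fin n) ℝ)
    (hP_nonneg : ∀ i j, 0 ≤ P i j) (hP_row : ∀ i, ∑ j, P i j = 1) (l : ℕ) :
    (∀ i j, 0 ≤ (P ^ l) i j) ∧ ∀ i, ∑ j, (P ^ l) i j = 1 := by
  induction l with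
  | zero =>
    refine ⟨fun i j => ?_, fun i => ?_⟩
    · rw [pow_zero, Matrix.one_apply]; split_ifs <;> norm_num
    · simp [Matrix.one_apply]
  | succ l ih =>
    refine ⟨fun i j => ?_, fun i => ?_⟩
    · rw [pow_succ, Matrix.mul_apply]
      exact Finset.sum_nonneg fun k _ => mul_nonneg (ih.1 i k) (hP_nonneg k j)
    · simp only [pow_succ, Matrix.mul_apply]
      rw [Finset.sum_comm]
      simp only [← Finset.mul_sum, hP_row, mul_one]
      exact ih.2 i

/-- Theorem 1: For every integer L ≥ 0,
`‖S_L − S‖_∞ ≤ (∏_{k=0}^{L} (1 − α_k)) · ‖S‖_∞`. -/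
theorem stmt_5 (n : ℕ) (hn : 0 < n) (P : Matrix (Fin n) (Fin n) ℝ)
    (hP_nonneg : ∀ i j, 0 ≤ P i j) (hP_row : ∀ i, ∑ j, P i j = 1)
    (α : ℕ → ℝ) (αmin : ℝ) (hαmin_pos : 0 < αmin) (hαmin_le : αmin ≤ 1)
    (hα : ∀ k : ℕ, αmin ≤ α k ∧ α k ≤ 1) (L : ℕ) :
    infNorm (supPPRTrunc n P α L - supPPR n P α) ≤
      (∏ k ∈ Finset.range (L + 1), (1 - α k)) * infNorm (supPPR n P α) := by
  have hnn := aux_prod_nonneg α (fun k => (hα k).2)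
  have hα0 : ∀ k, 0 ≤ α k := fun k => by linarith [(hα k).1]
  have hpow := aux_pow n P hP_nonneg hP_row
  have hsum := aux_hasSum α αmin hαmin_pos hαmin_le hα
  have hpos : ∀ l i j,
      0 ≤ α (l + 1) * (∏ k ∈ Finset.range (l + 1), (1 - α k)) * (P ^ (l + 1)) i j :=
    fun l i j => mul_nonneg (mul_nonneg (hα0 _) (hnn _)) ((hpow _).1 i j)
  have hsm : ∀ i j, Summable fun l : ℕ =>
      α (l + 1) * (∏ k ∈ Finset.range (l + 1), (1 - α k)) * (P ^ (l + 1)) i j := by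
    intro i j
    refine Summable.of_nonneg_of_le (fun l => hpos l i j) (fun l => ?_) (hsum 1).summable
    refine mul_le_of_le_one_right (mul_nonneg (hα0 _) (hnn _)) ?_
    rw [← (hpow (l + 1)).2 i]
    exact Finset.single_le_sum (fun j _ => (hpow (l + 1)).1 i j) (Finset.mem_univ j)
  have htail : ∀ (M : ℕ) (i : Fin n), ∑ j, ∑' l : ℕ,
      α (l + M + 1) * (∏ k ∈ Finset.range (l + M + 1), (1 - α k)) * (P ^ (l + M + 1)) i j
      = ∏ k ∈ Finset.range (M + 1), (1 - α k) := by
    intro M i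
    rw [← Summable.tsum_finsetSum (fun j _ => (summable_nat_add_iff M).2 (hsm i j))]
    simp only [← Finset.mul_sum, (hpow _).2, mul_one]
    exact (hsum (M + 1)).tsum_eq
  have hS : ∀ i, ∑ j, |supPPR n P α i j| = 1 := by
    intro i
    have : ∀ j, |supPPR n P α i j| = supPPR n P α i j := by
      intro j
      apply abs_of_nonneg
      simp only [supPPR, Matrix.of_apply]
      refine add_nonneg (mul_nonneg (hα0 _) (by split_ifs <;> norm_num))
        (tsum_nonneg fun l => hpos l i j)
    simp only [this]
    simp only [supPPR, Matrix.of_apply, Finset.sum_add_distrib]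
    have h := htail 0 i
    simp only [add_zero] at h
    rw [h]
    simp
  have hD : ∀ i, ∑ j, |(supPPRTrunc n P α L - supPPR n P α) i j|
      = ∏ k ∈ Finset.range (L + 1), (1 - α k) := by
    intro i
    rw [← htail L i]
    refine Finset.sum_congr rfl fun j _ => ?_
    have h := (hsm i j).sum_add_tsum_nat_add L
    rw [Matrix.sub_apply, abs_sub_comm, supPPR, supPPRTrunc, Matrix.of_apply, Matrix.of_apply,
      ← h, add_sub_add_left_eq_sub, add_sub_cancel_left]
    exact abs_of_nonneg (tsum_nonneg fun l => hpos (l + L) i j)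
  haveI : Nonempty (Fin n) := ⟨⟨0, hn⟩⟩
  simp only [infNorm, hS, hD, ciSup_const, mul_one, le_refl]
end

section
/- For every hop index k ≥ 0 and all nodes u, q, the function h satisfies the recurrence h_u^k(q) = α_k · [q = u] + (1 − α_k) · Σ_{o ∈ V} P(q, o) · h_u^{k+1}(o). -/
/-- `h_u^k(v) = α_k · [v = u] + Σ_{l=1}^{∞} α_{k+l} · (∏_{j=k}^{k+l-1} (1 − α_j)) · P^l(v, u)`,
defined entrywise via a `tsum` (the series converges absolutely under the standing
hypotheses `α_min ≤ α_j ≤ 1`). The infinite sum is indexed by `l : ℕ` standing for the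
hop `l + 1 ≥ 1`. -/
noncomputable def hFun {V : Type*} [Fintype V] [DecidableEq V]
    (P : Matrix V V ℝ) (α : ℕ → ℝ) (u : V) (k : ℕ) (v : V) : ℝ :=
  α k * (if v = u then 1 else 0) +
    ∑' l : ℕ, α (k + (l + 1)) * (∏ j ∈ Finset.range (l + 1), (1 - α (k + j))) *
      (P ^ (l + 1)) v u

/-- The general term of the series. -/
noncomputable def hTerm {V : Type*} [Fintype V] [DecidableEq V]
    (P : Matrix V V ℝ) (α : ℕ → ℝ) (u : V) (k : ℕ) (v : V) (l : ℕ) : ℝ :=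
  α (k + l) * (∏ j ∈ Finset.range l, (1 - α (k + j))) * (P ^ l) v u

theorem pow_stoch {V : Type*} [Fintype V] [DecidableEq V] (P : Matrix V V ℝ)
    (h0 : ∀ u v, 0 ≤ P u v) (h1 : ∀ u, ∑ v, P u v = 1) (l : ℕ) (u v : V) :
    0 ≤ (P ^ l) u v ∧ (P ^ l) u v ≤ 1 := by
  induction l generalizing u with
  | zero =>
    simp only [pow_zero, Matrix.one_apply]
    split_ifs <;> norm_num
  | succ l ih =>
    rw [pow_succ', Matrix.mul_apply]
    constructor
    · exact Finset.sum_nonneg fun o _ => mul_nonneg (h0 _ _) (ih o).1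
    · calc ∑ o, P u o * (P ^ l) o v ≤ ∑ o, P u o :=
            Finset.sum_le_sum fun o _ => mul_le_of_le_one_right (h0 _ _) (ih o).2
        _ = 1 := h1 u

theorem hTerm_summable {V : Type*} [Fintype V] [DecidableEq V] (P : Matrix V V ℝ)
    (h0 : ∀ u v, 0 ≤ P u v) (h1 : ∀ u, ∑ v, P u v = 1)
    (α : ℕ → ℝ) (αmin : ℝ) (hpos : 0 < αmin) (hle : αmin ≤ 1)
    (hα : ∀ k : ℕ, αmin ≤ α k ∧ α k ≤ 1) (u : V) (k : ℕ) (v : V) :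
    Summable (hTerm P α u k v) := by
  have hg : Summable fun l : ℕ => (1 - αmin) ^ l :=
    summable_geometric_of_lt_one (by linarith) (by linarith)
  have hp : ∀ l, 0 ≤ ∏ j ∈ Finset.range l, (1 - α (k + j)) := fun l =>
    Finset.prod_nonneg fun j _ => by linarith [(hα (k + j)).2]
  have ha : ∀ l, 0 ≤ α l := fun l => hpos.le.trans (hα l).1
  refine Summable.of_nonneg_of_le (fun l => ?_) (fun l => ?_) hg
  · exact mul_nonneg (mul_nonneg (ha _) (hp l)) (pow_stoch P h0 h1 l v u).1
  · have hb : ∏ j ∈ Finset.range l, (1 - α (k + j)) ≤ (1 - αmin) ^ l := by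
      calc _ ≤ ∏ j ∈ Finset.range l, (1 - αmin) :=
            Finset.prod_le_prod (fun j _ => by linarith [(hα (k + j)).2])
              (fun j _ => by linarith [(hα (k + j)).1])
        _ = _ := by simp
    unfold hTerm
    refine (mul_le_of_le_one_right (mul_nonneg (ha _) (hp l)) (pow_stoch P h0 h1 l v u).2).trans ?_
    exact (mul_le_of_le_one_left (hp l) (hα _).2).trans hb

theorem hFun_eq {V : Type*} [Fintype V] [DecidableEq V] (P : Matrix V V ℝ)
    (α : ℕ → ℝ) (u : V) (k : ℕ) (v : V) (hs : Summable (hTerm P α u k v)) :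
    hFun P α u k v = ∑' l, hTerm P α u k v l := by
  rw [hs.tsum_eq_zero_add]
  simp [hFun, hTerm, Matrix.one_apply]

/-- For every hop index `k ≥ 0` and all nodes `u, q`, the function `h`
satisfies the recurrence
`h_u^k(q) = α_k · [q = u] + (1 − α_k) · Σ_{o ∈ V} P(q, o) · h_u^{k+1}(o)`. -/
theorem stmt_9 {V : Type*} [Fintype V] [DecidableEq V] (G : SimpleGraph V)
    [DecidableRel G.Adj] (hd : ∀ v, 0 < G.degree v)
    (P : Matrix V V ℝ)
    (hP : ∀ u v, P u v = if G.Adj u v then (1 : ℝ) / (G.degree u : ℝ) else 0)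
    (α : ℕ → ℝ) (αmin : ℝ) (hαmin_pos : 0 < αmin) (hαmin_le : αmin ≤ 1)
    (hα : ∀ k : ℕ, αmin ≤ α k ∧ α k ≤ 1)
    (k : ℕ) (u q : V) :
    hFun P α u k q =
      α k * (if q = u then 1 else 0) +
        (1 - α k) * ∑ o, P q o * hFun P α u (k + 1) o := by
  have h0 : ∀ u v, 0 ≤ P u v := fun u v => by
    rw [hP]; split_ifs <;> positivity
  have h1 : ∀ u, ∑ v, P u v = 1 := fun u => by
    have hne : (G.degree u : ℝ) ≠ 0 := by exact_mod_cast (hd u).ne'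
    simp only [hP]
    rw [← Finset.sum_filter, Finset.sum_const, ← SimpleGraph.neighborFinset_eq_filter,
      SimpleGraph.card_neighborFinset_eq_degree, nsmul_eq_mul]
    field_simp
  have hs := hTerm_summable P h0 h1 α αmin hαmin_pos hαmin_le hα u
  have key : ∑ o, P q o * hFun P α u (k + 1) o
      = ∑' l, ∑ o, P q o * hTerm P α u (k + 1) o l := by
    rw [Summable.tsum_finsetSum (fun o _ => (hs (k + 1) o).mul_left _)]
    exact Finset.sum_congr rfl fun o _ => by rw [hFun_eq _ _ _ _ _ (hs _ _), tsum_mul_left]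
  rw [key, ← tsum_mul_left]
  unfold hFun
  congr 1
  refine tsum_congr fun l => ?_
  rw [pow_succ', Matrix.mul_apply, Finset.prod_range_succ', Finset.mul_sum, Finset.mul_sum]
  refine Finset.sum_congr rfl fun o _ => ?_
  have e : ∀ j, α (k + (j + 1)) = α (k + 1 + j) := fun j => by congr 1; omega
  have e2 : ∏ j ∈ Finset.range l, (1 - α (k + (j + 1)))
      = ∏ j ∈ Finset.range l, (1 - α (k + 1 + j)) :=
    Finset.prod_congr rfl fun j _ => by rw [e]
  rw [e2, e l]
  unfold hTerm
  rw [add_zero]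
  ring
end

section
/- For every hop index k ≥ 0 and every node u: Σ_{v ∈ V} d(v) · h_u^k(v) = d(u). -/
/-- For every hop index `k ≥ 0` and every node `u`:
`Σ_{v ∈ V} d(v) · h_u^k(v) = d(u)`. -/
theorem stmt_11 {V : Type*} [Fintype V] [DecidableEq V] (G : SimpleGraph V)
    [DecidableRel G.Adj] (hd : ∀ v, 0 < G.degree v)
    (P : Matrix V V ℝ)
    (hP : ∀ u v, P u v = if G.Adj u v then (1 : ℝ) / (G.degree u : ℝ) else 0)
    (α : ℕ → ℝ) (αmin : ℝ) (hαmin_pos : 0 < αmin) (hαmin_le : αmin ≤ 1)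
    (hα : ∀ k : ℕ, αmin ≤ α k ∧ α k ≤ 1)
    (k : ℕ) (u : V) :
    ∑ v, (G.degree v : ℝ) * hFun P α u k v = (G.degree u : ℝ) := by
  have hdpos : ∀ v, (1 : ℝ) ≤ (G.degree v : ℝ) := fun v => by exact_mod_cast hd v
  have hPnn : ∀ l : ℕ, ∀ v w, 0 ≤ (P ^ l) v w := by
    intro l
    induction l with
    | zero =>
      intro v w
      rw [pow_zero, Matrix.one_apply]
      split_ifs <;> norm_num
    | succ l ih =>
      intro v w
      rw [pow_succ, Matrix.mul_apply]
      refine Finset.sum_nonneg fun x _ => mul_nonneg (ih v x) ?_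
      rw [hP]
      split_ifs <;> positivity
  have hstat1 : ∀ w, ∑ v, (G.degree v : ℝ) * P v w = (G.degree w : ℝ) := by
    intro w
    have h1 : ∀ v, (G.degree v : ℝ) * P v w = if G.Adj w v then 1 else 0 := by
      intro v
      have := hdpos v
      rw [hP]
      by_cases h : G.Adj v w
      · rw [if_pos h, if_pos h.symm]
        field_simp
      · rw [if_neg h, if_neg (fun h' => h h'.symm), mul_zero]
    rw [Finset.sum_congr rfl (fun v _ => h1 v), Finset.sum_boole,
      ← G.card_neighborFinset_eq_degree, G.neighborFinset_eq_filter]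
  have hstat : ∀ l : ℕ, ∀ w, ∑ v, (G.degree v : ℝ) * (P ^ l) v w = (G.degree w : ℝ) := by
    intro l
    induction l with
    | zero => intro w; simp [Matrix.one_apply]
    | succ l ih =>
      intro w
      simp only [pow_succ, Matrix.mul_apply, Finset.mul_sum]
      rw [Finset.sum_comm, ← hstat1 w]
      refine Finset.sum_congr rfl fun x _ => ?_
      rw [← ih x, Finset.sum_mul]
      exact Finset.sum_congr rfl fun v _ => by ring
  have hPle : ∀ l : ℕ, ∀ v, (P ^ l) v u ≤ (G.degree u : ℝ) := by
    intro l v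
    rw [← hstat l u]
    refine le_trans ?_ (Finset.single_le_sum
      (f := fun v => (G.degree v : ℝ) * (P ^ l) v u)
      (fun i _ => mul_nonneg (Nat.cast_nonneg _) (hPnn l i u)) (Finset.mem_univ v))
    exact le_mul_of_one_le_left (hPnn l v u) (hdpos v)
  have hprodnn : ∀ l : ℕ, 0 ≤ ∏ j ∈ Finset.range l, (1 - α (k + j)) := fun l =>
    Finset.prod_nonneg fun j _ => by linarith [(hα (k + j)).2]
  have hprodle : ∀ l : ℕ, ∏ j ∈ Finset.range l, (1 - α (k + j)) ≤ (1 - αmin) ^ l := by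
    intro l
    calc ∏ j ∈ Finset.range l, (1 - α (k + j)) ≤ ∏ j ∈ Finset.range l, (1 - αmin) :=
          Finset.prod_le_prod (fun j _ => by linarith [(hα (k + j)).2])
            (fun j _ => by linarith [(hα (k + j)).1])
      _ = (1 - αmin) ^ l := by simp
  have htend : Filter.Tendsto (fun l : ℕ => ∏ j ∈ Finset.range l, (1 - α (k + j)))
      Filter.atTop (nhds 0) :=
    squeeze_zero hprodnn hprodle
      (tendsto_pow_atTop_nhds_zero_of_lt_one (by linarith) (by linarith))
  have hcnn : ∀ l : ℕ,
      0 ≤ α (k + (l + 1)) * (∏ j ∈ Finset.range (l + 1), (1 - α (k + j))) := fun l =>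
    mul_nonneg (by linarith [(hα (k + (l + 1))).1]) (hprodnn _)
  have hc : HasSum (fun l : ℕ =>
      α (k + (l + 1)) * (∏ j ∈ Finset.range (l + 1), (1 - α (k + j)))) (1 - α k) := by
    rw [hasSum_iff_tendsto_nat_of_nonneg hcnn]
    have hpart : ∀ n : ℕ, ∑ l ∈ Finset.range n,
        α (k + (l + 1)) * (∏ j ∈ Finset.range (l + 1), (1 - α (k + j))) =
        (1 - α k) - ∏ j ∈ Finset.range (n + 1), (1 - α (k + j)) := by
      intro n
      induction n with
      | zero => simp
      | succ n ih =>
        rw [Finset.sum_range_succ, ih, Finset.prod_range_succ _ (n + 1)]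
        ring
    simp only [hpart]
    simpa using ((Filter.tendsto_add_atTop_iff_nat 1).2 htend).const_sub (1 - α k)
  have hsum : ∀ v, Summable (fun l : ℕ =>
      α (k + (l + 1)) * (∏ j ∈ Finset.range (l + 1), (1 - α (k + j))) *
        (P ^ (l + 1)) v u) := fun v =>
    Summable.of_nonneg_of_le (fun l => mul_nonneg (hcnn l) (hPnn _ v u))
      (fun l => mul_le_mul_of_nonneg_left (hPle _ v) (hcnn l))
      (hc.summable.mul_right (G.degree u : ℝ))
  have htot := hasSum_sum (s := Finset.univ)
    (fun v _ => ((hsum v).hasSum.mul_left (G.degree v : ℝ)))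
  have heq : ∀ l : ℕ, ∑ v, (G.degree v : ℝ) *
      (α (k + (l + 1)) * (∏ j ∈ Finset.range (l + 1), (1 - α (k + j))) *
        (P ^ (l + 1)) v u) =
      α (k + (l + 1)) * (∏ j ∈ Finset.range (l + 1), (1 - α (k + j))) *
        (G.degree u : ℝ) := by
    intro l
    rw [← hstat (l + 1) u, Finset.mul_sum]
    exact Finset.sum_congr rfl fun v _ => by ring
  simp only [heq] at htot
  have hfin := htot.unique (hc.mul_right (G.degree u : ℝ))
  simp only [hFun, mul_add, Finset.sum_add_distrib]
  rw [hfin]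
  simp
  ring
end
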